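/- Let d = 2, let U_2 be the uniform measure on the unit ball of R^2 (with density u_2(x) = (2π)^{−1}|x|^{−1} on B_1), and let P = p(y)dy be a probability measure on R^2 whose density p satisfies 0 < λ_R ≤ p ≤ Λ_R almost everywhere on the ball B_R for every R < ∞. Let φ : B_1 → R be a convex function whose Lebesgue-a.e. defined gradient ∇φ pushes U_2 forward to P. Then the set K := ∂φ(0) is a single point, φ is differentiable at every point of B_1 (including the origin), and Q± := ∇φ is a homeomorphism from B_1 onto R^2. -/

import Mathlib

open MeasureTheory Metric Set
open scoped ENNReal RealInnerProductSpace

/-- The surface area `H^{d-1}(S^{d-1})` of the unit sphere in `ℝ^d`. -/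
noncomputable def sphereArea (d : ℕ) : ℝ :=
  (μH[(d : ℝ) - 1] (sphere (0 : EuclideanSpace ℝ (Fin d)) 1)).toReal

/-- The density `u_d(x) = c_d / |x|^{d-1}` with `c_d = 1 / H^{d-1}(S^{d-1})`. -/
noncomputable def uDens (d : ℕ) (x : EuclideanSpace ℝ (Fin d)) : ℝ :=
  (sphereArea d)⁻¹ / ‖x‖ ^ (d - 1)

/-- The "uniform" measure `U_d` on the unit ball, with density `u_d` on `B_1` and `0` outside. -/
noncomputable def unifBall (d : ℕ) : Measure (EuclideanSpace ℝ (Fin d)) :=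
  volume.withDensity
    ((ball (0 : EuclideanSpace ℝ (Fin d)) 1).indicator fun x => ENNReal.ofReal (uDens d x))

/-- A nonnegative convex function vanishing on a segment, after subtraction of its one-sided normal
derivative `s`, is controlled from both sides near the segment by its slopes `q` along one normal. -/
theorem exists_normal_slope {D : Set (ℝ × ℝ)} {H : ℝ × ℝ → ℝ} (hH : ConvexOn ℝ D H)
    {l T : ℝ} (hT : 0 < T) (hD : ∀ τ t : ℝ, |τ| ≤ l → t = 0 → (τ, t) ∈ D)
    (hDT : (0, T) ∈ D) (hpos : ∀ z ∈ D, 0 ≤ H z) (hzero : ∀ τ : ℝ, |τ| ≤ l → H (τ, 0) = 0)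
    (hl : 0 < l) :
    ∃ (s : ℝ) (q : ℝ → ℝ), (∀ t, 0 < t → t ≤ T → 0 ≤ q t) ∧
      (∀ t t', 0 < t → t ≤ t' → t' ≤ T → q t ≤ q t') ∧
      (∀ ε, 0 < ε → ∃ t, 0 < t ∧ t ≤ T ∧ q t < ε) ∧
      ∀ τ t, |τ| ≤ l / 2 → 0 < t → t ≤ T / 2 → (τ, t) ∈ D ∧
        t * q (t / 2) ≤ H (τ, t) - s * t ∧ H (τ, t) - s * t ≤ t * q (2 * t) := by
  have hmid : ∀ {a b : ℝ × ℝ}, a ∈ D → b ∈ D → ∀ c : ℝ × ℝ, c.1 = (a.1 + b.1) / 2 →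
      c.2 = (a.2 + b.2) / 2 → c ∈ D ∧ 2 * H c ≤ H a + H b := by
    intro a b ha hb c h1 h2
    have hc : c = (1 / 2 : ℝ) • a + (1 / 2 : ℝ) • b := by
      ext
      · simp [h1]; ring
      · simp [h2]; ring
    have h3 := hH.2 ha hb (show (0 : ℝ) ≤ 1 / 2 by norm_num) (show (0 : ℝ) ≤ 1 / 2 by norm_num)
      (by norm_num)
    rw [← hc] at h3
    refine ⟨hc ▸ hH.1 ha hb (by norm_num) (by norm_num) (by norm_num), ?_⟩
    simp only [smul_eq_mul] at h3
    linarith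
  have hray : ∀ t t' : ℝ, 0 ≤ t → t ≤ t' → 0 < t' → (0, t') ∈ D →
      (0, t) ∈ D ∧ t' * H (0, t) ≤ t * H (0, t') := by
    intro t t' ht htt ht' hD'
    have h0 : ((0 : ℝ), (0 : ℝ)) ∈ D := hD 0 0 (by simpa using hl.le) rfl
    have hc : ((0 : ℝ), t) = (1 - t / t') • ((0 : ℝ), (0 : ℝ)) + (t / t') • ((0 : ℝ), t') := by
      ext
      · simp
      · simp; field_simp
    have hb1 : t / t' ≤ 1 := by rw [div_le_one ht']; exact htt
    have hb0 : 0 ≤ t / t' := by positivity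
    have h3 := hH.2 h0 hD' (show 0 ≤ 1 - t / t' by linarith) hb0 (by ring)
    rw [← hc] at h3
    refine ⟨hc ▸ hH.1 h0 hD' (by linarith) hb0 (by ring), ?_⟩
    rw [hzero 0 (by simpa using hl.le)] at h3
    simp only [smul_eq_mul, mul_zero, zero_add] at h3
    calc t' * H (0, t) ≤ t' * (t / t' * H (0, t')) := by gcongr
      _ = t * H (0, t') := by field_simp
  have hmem : ∀ t : ℝ, 0 ≤ t → t ≤ T → ((0 : ℝ), t) ∈ D := fun t h0 h1 =>
    (hray t T h0 h1 hT hDT).1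
  set S : Set ℝ := (fun t => H (0, t) / t) '' Ioc 0 T with hS
  have hbdd : BddBelow S := ⟨0, by
    rintro _ ⟨t, ⟨ht0, htT⟩, rfl⟩
    exact div_nonneg (hpos _ (hmem t ht0.le htT)) ht0.le⟩
  have hne : S.Nonempty := ⟨_, T, ⟨hT, le_rfl⟩, rfl⟩
  refine ⟨sInf S, fun t => H (0, t) / t - sInf S, ?_, ?_, ?_, ?_⟩
  · intro t h0 h1
    have := csInf_le hbdd (mem_image_of_mem (fun t => H (0, t) / t) (show t ∈ Ioc 0 T from ⟨h0, h1⟩))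
    simpa using this
  · intro t t' h0 h1 h2
    have := (hray t t' h0.le h1 (by linarith) (hmem t' (by linarith) h2)).2
    have h3 : H (0, t) / t ≤ H (0, t') / t' := by
      rw [div_le_div_iff₀ h0 (by linarith)]; linarith
    simpa using h3
  · intro ε hε
    obtain ⟨_, ⟨t, ⟨h0, h1⟩, rfl⟩, h2⟩ := exists_lt_of_csInf_lt hne
      (show sInf S < sInf S + ε by linarith)
    exact ⟨t, h0, h1, by simpa [sub_lt_iff_lt_add'] using h2⟩
  · intro τ t hτ h0 h1
    have hτ' : |2 * τ| ≤ l := by rw [abs_mul, abs_two]; linarith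
    have hup := hmid (hmem (2 * t) (by linarith) (by linarith)) (hD (2 * τ) 0 hτ' rfl) (τ, t)
      (by simp) (by simp)
    have hlo := hmid hup.1 (hD (-τ) 0 (by rw [abs_neg]; linarith) rfl) (0, t / 2)
      (by simp) (by simp)
    refine ⟨hup.1, ?_, ?_⟩
    · have := hlo.2
      rw [hzero (-τ) (by rw [abs_neg]; linarith)] at this
      have e : t * (H (0, t / 2) / (t / 2) - sInf S) = 2 * H (0, t / 2) - sInf S * t := by
        field_simp
      simp only [e]; linarith
    · have := hup.2
      rw [hzero (2 * τ) hτ'] at this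
      have e : t * (H (0, 2 * t) / (2 * t) - sInf S) = H (0, 2 * t) / 2 - sInf S * t := by
        field_simp
      simp only [e]; linarith

/-- Bounds for the subgradients of a convex function near a segment on which it is affine, in terms
of the slopes provided by `exists_normal_slope`. -/
theorem subgradient_bounds {D : Set (ℝ × ℝ)} {H : ℝ × ℝ → ℝ} {l T s : ℝ} {q : ℝ → ℝ} (hl : 0 < l)
    (hD : ∀ τ t : ℝ, |τ| ≤ l → t = 0 → (τ, t) ∈ D)
    (hzero : ∀ τ : ℝ, |τ| ≤ l → H (τ, 0) = 0)
    (hq0 : ∀ t, 0 < t → t ≤ T → 0 ≤ q t)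
    (hmono : ∀ t t', 0 < t → t ≤ t' → t' ≤ T → q t ≤ q t')
    (hq : ∀ τ t, |τ| ≤ l / 2 → 0 < t → t ≤ T / 2 → (τ, t) ∈ D ∧
        t * q (t / 2) ≤ H (τ, t) - s * t ∧ H (τ, t) - s * t ≤ t * q (2 * t))
    {h τ t x y : ℝ} (hh : 0 < h) (hhT : 8 * h ≤ T) (hτ : |τ| ≤ l / 4) (ht : h ≤ t) (ht' : t ≤ 2 * h)
    (hsub : ∀ z ∈ D, H (τ, t) + (x * (z.1 - τ) + y * (z.2 - t)) ≤ H z) :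
    |x| ≤ 8 / l * h * q (4 * h) ∧ q (h / 2) ≤ y - s ∧ y - s ≤ 2 * q (8 * h) := by
  have ht0 : 0 < t := by linarith
  obtain ⟨hτ1, hτ2⟩ := abs_le.1 hτ
  have h1 := hq τ t (by linarith) ht0 (by linarith)
  have hqt : 0 ≤ q (t / 2) := hq0 _ (by linarith) (by linarith)
  have hGt : 0 ≤ t * q (t / 2) := by positivity
  have hq2 : t * q (2 * t) ≤ 2 * h * q (4 * h) := by
    have a1 : q (2 * t) ≤ q (4 * h) := hmono _ _ (by linarith) (by linarith) (by linarith)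
    have a2 : 0 ≤ q (2 * t) := hq0 _ (by linarith) (by linarith)
    calc t * q (2 * t) ≤ (2 * h) * q (2 * t) := by gcongr
      _ ≤ _ := by gcongr
  refine ⟨?_, ?_, ?_⟩
  · have hr := hq (τ + l / 4) t (abs_le.2 ⟨by linarith, by linarith⟩) ht0 (by linarith)
    have hle := hq (τ - l / 4) t (abs_le.2 ⟨by linarith, by linarith⟩) ht0 (by linarith)
    have s1 := hsub _ hr.1
    have s2 := hsub _ hle.1
    simp only at s1 s2
    have k1 : x * (l / 4) ≤ 2 * h * q (4 * h) := by nlinarith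
    have k2 : -x * (l / 4) ≤ 2 * h * q (4 * h) := by nlinarith
    have e : 8 / l * h * q (4 * h) = (2 * h * q (4 * h)) / (l / 4) := by field_simp; ring
    rw [e, le_div_iff₀ (by linarith)]
    rcases abs_cases x with ⟨hx, -⟩ | ⟨hx, -⟩ <;> rw [hx] <;> linarith
  · have s1 := hsub _ (hD τ 0 (by linarith) rfl)
    rw [hzero τ (by linarith)] at s1
    simp only at s1
    have k : t * q (t / 2) ≤ t * (y - s) := by nlinarith [h1.2.1]
    have k' := le_of_mul_le_mul_left k ht0
    exact (hmono _ _ (by linarith) (by linarith) (by linarith)).trans k'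
  · have hr := hq τ (2 * t) (by linarith) (by linarith) (by linarith)
    have s1 := hsub _ hr.1
    simp only at s1
    have k : t * (y - s) ≤ t * (2 * q (2 * (2 * t))) := by nlinarith [h1.2.1, hr.2.2]
    have k' := le_of_mul_le_mul_left k ht0
    have := hmono (2 * (2 * t)) (8 * h) (by linarith) (by linarith) (by linarith)
    linarith

/-- A slope function that is at least linear cannot decay quadratically along geometric scales. -/
theorem not_quadratic_decay {q : ℝ → ℝ} {T c C : ℝ} (hc : 0 < c) (hC : 0 < C)
    (hmono : ∀ t t', 0 < t → t ≤ t' → t' ≤ T → q t ≤ q t')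
    (hlim : ∀ ε, 0 < ε → ∃ t, 0 < t ∧ t ≤ T ∧ q t < ε)
    (hlow : ∀ t, 0 < t → t ≤ T → c * t ≤ q t)
    (hdecay : ∀ t, 0 < t → t ≤ T → q (t / 16) ≤ C * q t ^ 2) : False := by
  obtain ⟨t, ht0, htT, hqt⟩ := hlim (1 / (32 * C)) (by positivity)
  have key : ∀ n : ℕ, q (t / 16 ^ n) ≤ q t / 32 ^ n := by
    intro n
    induction n with
    | zero => simp
    | succ n ih =>
      have hp : 0 < t / 16 ^ n := by positivity
      have hle : t / 16 ^ n ≤ t := div_le_self ht0.le (one_le_pow₀ (by norm_num))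
      have h1 := hdecay _ hp (hle.trans htT)
      have h2 := hmono _ _ hp hle htT
      have h3 : 0 ≤ q (t / 16 ^ n) := le_trans (by positivity) (hlow _ hp (hle.trans htT))
      have h4 : C * q (t / 16 ^ n) ≤ 1 / 32 := by
        calc C * q (t / 16 ^ n) ≤ C * (1 / (32 * C)) := by gcongr; linarith
          _ = 1 / 32 := by field_simp
      calc q (t / 16 ^ (n + 1)) = q (t / 16 ^ n / 16) := by rw [pow_succ, div_div]
        _ ≤ (C * q (t / 16 ^ n)) * q (t / 16 ^ n) := by linarith [h1, sq (q (t / 16 ^ n))]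
        _ ≤ 1 / 32 * (q t / 32 ^ n) := by gcongr
        _ = q t / 32 ^ (n + 1) := by rw [pow_succ]; field_simp
  have hqpos : 0 < q t := lt_of_lt_of_le (by positivity) (hlow t ht0 htT)
  obtain ⟨n, hn⟩ := pow_unbounded_of_one_lt (q t / (c * t)) (one_lt_two : (1 : ℝ) < 2)
  have h1 := key n
  have h2 := hlow (t / 16 ^ n) (by positivity)
    ((div_le_self ht0.le (one_le_pow₀ (by norm_num))).trans htT)
  rw [div_lt_iff₀ (by positivity)] at hn
  have h3 : c * (t / 16 ^ n) ≤ q t / 32 ^ n := h2.trans h1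
  have e : (32 : ℝ) ^ n = 2 ^ n * 16 ^ n := by rw [← mul_pow]; norm_num
  rw [e, mul_div_assoc', div_le_div_iff₀ (by positivity) (by positivity)] at h3
  have h4 : (16 : ℝ) ^ n * (2 ^ n * (c * t)) ≤ 16 ^ n * q t := by linarith
  have := le_of_mul_le_mul_left h4 (by positivity)
  linarith

/-- The subdifferential at `x` of a function `F` with domain `Ω`. -/
def subgrad (Ω : Set (EuclideanSpace ℝ (Fin 2))) (F : EuclideanSpace ℝ (Fin 2) → ℝ)
    (x : EuclideanSpace ℝ (Fin 2)) : Set (EuclideanSpace ℝ (Fin 2)) :=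
  {q | ∀ z ∈ Ω, F x + ⟪q, z - x⟫ ≤ F z}

/-- The closed rectangle with corner coordinates relative to the origin `o` and the frame `b`. -/
def frameBox (b : OrthonormalBasis (Fin 2) ℝ (EuclideanSpace ℝ (Fin 2)))
    (o : EuclideanSpace ℝ (Fin 2)) (a₁ a₂ c₁ c₂ : ℝ) : Set (EuclideanSpace ℝ (Fin 2)) :=
  {x | ⟪b 0, x - o⟫ ∈ Icc a₁ a₂ ∧ ⟪b 1, x - o⟫ ∈ Icc c₁ c₂}

theorem measurableSet_frameBox (b : OrthonormalBasis (Fin 2) ℝ (EuclideanSpace ℝ (Fin 2)))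
    (o : EuclideanSpace ℝ (Fin 2)) (a₁ a₂ c₁ c₂ : ℝ) :
    MeasurableSet (frameBox b o a₁ a₂ c₁ c₂) := by
  have h : ∀ v : EuclideanSpace ℝ (Fin 2), Continuous fun x => ⟪v, x - o⟫ := fun v => by fun_prop
  exact ((isClosed_Icc.preimage (h _)).inter (isClosed_Icc.preimage (h _))).measurableSet

theorem volume_frameBox (b : OrthonormalBasis (Fin 2) ℝ (EuclideanSpace ℝ (Fin 2)))
    (o : EuclideanSpace ℝ (Fin 2)) (a₁ a₂ c₁ c₂ : ℝ) :
    volume (frameBox b o a₁ a₂ c₁ c₂) = ENNReal.ofReal (a₂ - a₁) * ENNReal.ofReal (c₂ - c₁) := by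
  have h1 : MeasurePreserving (fun x : EuclideanSpace ℝ (Fin 2) => x - o) volume volume :=
    measurePreserving_sub_right volume o
  have h2 := (PiLp.volume_preserving_ofLp (Fin 2)).comp (b.measurePreserving_repr.comp h1)
  have hset : frameBox b o a₁ a₂ c₁ c₂ =
      ((@WithLp.ofLp 2 (Fin 2 → ℝ)) ∘ b.repr ∘ fun x => x - o) ⁻¹' (Icc ![a₁, c₁] ![a₂, c₂]) := by
    ext x
    simp only [frameBox, mem_ofPred_eq, mem_Icc, mem_preimage, Function.comp, Pi.le_def,
      Fin.forall_fin_two, b.repr_apply_apply, Matrix.cons_val_zero, Matrix.cons_val_one]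
    tauto
  rw [hset, h2.measure_preimage measurableSet_Icc.nullMeasurableSet, Real.volume_Icc_pi]
  simp [Fin.prod_univ_two]

theorem norm_sq_frame (b : OrthonormalBasis (Fin 2) ℝ (EuclideanSpace ℝ (Fin 2)))
    (x : EuclideanSpace ℝ (Fin 2)) : ‖x‖ ^ 2 = ⟪b 0, x⟫ ^ 2 + ⟪b 1, x⟫ ^ 2 := by
  rw [← b.sum_sq_norm_inner_right x]
  simp [Fin.sum_univ_two]

theorem inner_frame (b : OrthonormalBasis (Fin 2) ℝ (EuclideanSpace ℝ (Fin 2)))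
    (x y : EuclideanSpace ℝ (Fin 2)) : ⟪x, y⟫ = ⟪b 0, x⟫ * ⟪b 0, y⟫ + ⟪b 1, x⟫ * ⟪b 1, y⟫ := by
  rw [← b.sum_inner_mul_inner x y]
  simp [Fin.sum_univ_two, real_inner_comm]

theorem exists_frame {v : EuclideanSpace ℝ (Fin 2)} (hv : ‖v‖ = 1) :
    ∃ b : OrthonormalBasis (Fin 2) ℝ (EuclideanSpace ℝ (Fin 2)), b 0 = v := by
  have h : Orthonormal ℝ (({0} : Set (Fin 2)).domRestrict fun _ : Fin 2 => v) := by
    refine ⟨fun _ => hv, fun i j hij => ?_⟩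
    exact absurd (Subsingleton.elim i j) hij
  obtain ⟨b, hb⟩ := h.exists_orthonormalBasis_extension_of_card_eq (by simp)
  exact ⟨b, hb 0 rfl⟩

/-- Near `x₀` the measure `ν` is dominated by a multiple of `|x - x₀|⁻¹ dx`. -/
def InvDistBound (ν : Measure (EuclideanSpace ℝ (Fin 2))) (x₀ : EuclideanSpace ℝ (Fin 2)) : Prop :=
  ∃ C : ℝ, 0 < C ∧ ∃ ρ₀ : ℝ, 0 < ρ₀ ∧
    (∀ ρ : ℝ, 0 ≤ ρ → ρ ≤ ρ₀ → ν (closedBall x₀ ρ) ≤ ENNReal.ofReal (C * ρ)) ∧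
    ∀ (α : ℝ) (B : Set (EuclideanSpace ℝ (Fin 2))), 0 < α → MeasurableSet B →
      B ⊆ closedBall x₀ ρ₀ → (∀ x ∈ B, α ≤ ‖x - x₀‖) →
      ν B ≤ ENNReal.ofReal (C / α) * volume B

set_option maxHeartbeats 1000000 in
/-- Two-dimensional strict convexity: if `F` spreads area at least as much as a measure `ν` with at
most a `|x - x₀|⁻¹` singularity allows, then `F` is affine on no segment. -/
theorem eq_of_common_subgradient {Ω : Set (EuclideanSpace ℝ (Fin 2))} (hΩ : IsOpen Ω)
    {F : EuclideanSpace ℝ (Fin 2) → ℝ} (hF : ConvexOn ℝ Ω F)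
    (ν : Measure (EuclideanSpace ℝ (Fin 2)))
    (hFν : ∀ R : ℝ, 0 < R → ∃ lam : ℝ, 0 < lam ∧ ∀ A B : Set (EuclideanSpace ℝ (Fin 2)),
      MeasurableSet A → MeasurableSet B → A ⊆ Ω → A ⊆ ball 0 R →
      (∀ y ∈ A, subgrad Ω F y ⊆ B) → ENNReal.ofReal lam * volume A ≤ ν B)
    (hν : ∀ x₀, InvDistBound ν x₀)
    {a b ξ : EuclideanSpace ℝ (Fin 2)} (ha : a ∈ Ω) (hb : b ∈ Ω)
    (hξa : ξ ∈ subgrad Ω F a) (hξb : ξ ∈ subgrad Ω F b) : a = b := by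
  by_contra hab
  have hnorm : 0 < ‖b - a‖ := norm_pos_iff.2 (sub_ne_zero.2 (Ne.symm hab))
  obtain ⟨e, he⟩ := exists_frame (v := (‖b - a‖⁻¹ : ℝ) • (b - a))
    (by rw [norm_smul, norm_inv, norm_norm, inv_mul_cancel₀ hnorm.ne'])
  set l : ℝ := ‖b - a‖ / 2 with hldef
  have hl : 0 < l := by positivity
  set o : EuclideanSpace ℝ (Fin 2) := a + l • e 0 with ho
  have hba : b = a + (2 * l) • e 0 := by
    rw [he, smul_smul, hldef, mul_div_cancel₀ _ two_ne_zero, mul_inv_cancel₀ hnorm.ne']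
    simp
  have he00 : ⟪e 0, e 0⟫ = (1 : ℝ) := by simp
  have he11 : ⟪e 1, e 1⟫ = (1 : ℝ) := by simp
  have he01 : ⟪e 0, e 1⟫ = (0 : ℝ) := e.orthonormal.2 (by decide)
  have he10 : ⟪e 1, e 0⟫ = (0 : ℝ) := e.orthonormal.2 (by decide)
  set pt : ℝ × ℝ → EuclideanSpace ℝ (Fin 2) := fun z => o + z.1 • e 0 + z.2 • e 1 with hpt
  have hptcomb : ∀ (x y : ℝ × ℝ) (r s : ℝ), r + s = 1 →
      pt (r • x + s • y) = r • pt x + s • pt y := by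
    intro x y r s hrs
    obtain rfl : s = 1 - r := by linarith
    simp only [hpt, Prod.fst_add, Prod.snd_add, Prod.smul_fst, Prod.smul_snd, smul_eq_mul]
    module
  set D : Set (ℝ × ℝ) := pt ⁻¹' Ω with hDdef
  set H : ℝ × ℝ → ℝ := fun z => F (pt z) - F a - ⟪ξ, pt z - a⟫ with hHdef
  have hH : ConvexOn ℝ D H := by
    refine ⟨?_, ?_⟩
    · intro x hx y hy r s hr hs hrs
      simp only [hDdef, mem_preimage, hptcomb x y r s hrs] at hx hy ⊢
      exact hF.1 hx hy hr hs hrs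
    · intro x hx y hy r s hr hs hrs
      have h1 := hF.2 hx hy hr hs hrs
      obtain rfl : s = 1 - r := by linarith
      simp only [hHdef, hptcomb x y r (1 - r) hrs, smul_eq_mul, inner_sub_right, inner_add_right,
        inner_smul_right] at h1 ⊢
      linarith
  have hpos : ∀ z ∈ D, 0 ≤ H z := fun z hz => by
    have := hξa _ hz
    simp only [hHdef]; linarith
  have hpa : pt (-l, 0) = a := by simp [hpt, ho]
  have hpb : pt (l, 0) = b := by
    rw [hba]; simp only [hpt, ho]; module
  have hHa : H (-l, 0) = 0 := by simp [hHdef, hpa]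
  have hHb : H (l, 0) = 0 := by
    refine le_antisymm ?_ (hpos _ (by simpa [hDdef, hpb] using hb))
    have := hξb a ha
    rw [← neg_sub b a, inner_neg_right] at this
    simp only [hHdef, hpb]; linarith
  have hseg : ∀ τ : ℝ, |τ| ≤ l → ((τ, 0) : ℝ × ℝ) ∈ D ∧ H (τ, 0) = 0 := by
    intro τ hτ
    obtain ⟨h1, h2⟩ := abs_le.1 hτ
    have haD : ((-l, 0) : ℝ × ℝ) ∈ D := by simpa [hDdef, hpa] using ha
    have hbD : ((l, 0) : ℝ × ℝ) ∈ D := by simpa [hDdef, hpb] using hb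
    have hr : 0 ≤ (l - τ) / (2 * l) := div_nonneg (by linarith) (by linarith)
    have hs : 0 ≤ (l + τ) / (2 * l) := div_nonneg (by linarith) (by linarith)
    have hrs : (l - τ) / (2 * l) + (l + τ) / (2 * l) = 1 := by field_simp; ring
    have hc : ((τ, 0) : ℝ × ℝ) =
        ((l - τ) / (2 * l)) • ((-l, 0) : ℝ × ℝ) + ((l + τ) / (2 * l)) • ((l, 0) : ℝ × ℝ) := by
      ext
      · simp; field_simp; ring
      · simp
    have hmem : ((τ, 0) : ℝ × ℝ) ∈ D := hc ▸ hH.1 haD hbD hr hs hrs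
    refine ⟨hmem, le_antisymm ?_ (hpos _ hmem)⟩
    have := hH.2 haD hbD hr hs hrs
    rw [← hc, hHa, hHb] at this
    simpa using this
  have hD : ∀ τ t : ℝ, |τ| ≤ l → t = 0 → (τ, t) ∈ D := by
    rintro τ t hτ rfl
    exact (hseg τ hτ).1
  have hzero : ∀ τ : ℝ, |τ| ≤ l → H (τ, 0) = 0 := fun τ hτ => (hseg τ hτ).2
  obtain ⟨T, hT, hDT⟩ : ∃ T : ℝ, 0 < T ∧ ((0, T) : ℝ × ℝ) ∈ D := by
    have ho' : o ∈ Ω := by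
      have : o = pt (0, 0) := by simp [hpt]
      rw [this]; exact (hseg 0 (by simpa using hl.le)).1
    obtain ⟨ε, hε, hball⟩ := Metric.isOpen_iff.1 hΩ o ho'
    refine ⟨ε / 2, by positivity, hball ?_⟩
    simp only [hpt, zero_smul, add_zero, mem_ball, dist_self_add_left, norm_smul]
    rw [e.orthonormal.1 1, Real.norm_of_nonneg (by positivity)]
    linarith
  obtain ⟨s, q, hq0, hmono, hlim, hq⟩ := exists_normal_slope hH hT hD hDT hpos hzero hl
  obtain ⟨lam, hlam, hA⟩ := hFν (‖o‖ + l + T) (by positivity)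
  set x₀ : EuclideanSpace ℝ (Fin 2) := ξ + s • e 1 with hx₀
  obtain ⟨C, hC, ρ₀, hρ₀, hνball, hνfar⟩ := hν x₀
  set C₁ : ℝ := 8 / l * T + 2 with hC₁
  have hC₁pos : 0 < C₁ := by positivity
  obtain ⟨T₁, hT₁, hT₁T, hqT₁⟩ := hlim (ρ₀ / C₁) (by positivity)
  set Box : ℝ → Set (EuclideanSpace ℝ (Fin 2)) := fun h =>
    frameBox e x₀ (-(8 / l * h * q (4 * h))) (8 / l * h * q (4 * h)) (q (h / 2)) (2 * q (8 * h))
    with hBox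
  have hmass : ∀ h, 0 < h → 8 * h ≤ T₁ → ENNReal.ofReal (lam * (l / 2 * h)) ≤ ν (Box h) := by
    intro h hh hhT
    have hcoord : ∀ y, pt (⟪e 0, y - o⟫, ⟪e 1, y - o⟫) = y := by
      intro y
      have := e.sum_repr' (y - o)
      rw [Fin.sum_univ_two] at this
      simp only [hpt, add_assoc, this]; abel
    have key := hA (frameBox e o (-(l / 4)) (l / 4) h (2 * h)) (Box h)
      (measurableSet_frameBox ..) (measurableSet_frameBox ..) ?_ ?_ ?_
    · rw [volume_frameBox, ← ENNReal.ofReal_mul (by linarith), ← ENNReal.ofReal_mul hlam.le] at key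
      convert key using 3
      ring
    · rintro y ⟨⟨h1, h2⟩, h3, h4⟩
      have := (hq ⟪e 0, y - o⟫ ⟪e 1, y - o⟫ (abs_le.2 ⟨by linarith, by linarith⟩)
        (by linarith) (by linarith)).1
      rwa [hDdef, mem_preimage, hcoord] at this
    · rintro y ⟨⟨h1, h2⟩, h3, h4⟩
      have hn := norm_sq_frame e (y - o)
      have hlt : ‖y - o‖ < l + T := by
        refine lt_of_pow_lt_pow_left₀ 2 (by positivity) ?_
        rw [hn]
        have k1 : ⟪e 0, y - o⟫ ^ 2 ≤ (l / 4) ^ 2 := sq_le_sq' h1 h2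
        have k2 : ⟪e 1, y - o⟫ ^ 2 ≤ T ^ 2 := sq_le_sq' (by linarith) (by linarith)
        nlinarith
      rw [mem_ball_zero_iff]
      calc ‖y‖ = ‖o + (y - o)‖ := by simp
        _ ≤ ‖o‖ + ‖y - o‖ := norm_add_le _ _
        _ < ‖o‖ + l + T := by linarith
    · rintro y ⟨⟨h1, h2⟩, h3, h4⟩ x hx
      have hsub : ∀ z ∈ D, H (⟪e 0, y - o⟫, ⟪e 1, y - o⟫) +
          (⟪e 0, x - ξ⟫ * (z.1 - ⟪e 0, y - o⟫) + ⟪e 1, x - ξ⟫ * (z.2 - ⟪e 1, y - o⟫)) ≤ H z := by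
        intro z hz
        have hxz := hx _ hz
        have hin := inner_frame e (x - ξ) (pt z - y)
        have hc0 : ⟪e 0, pt z - y⟫ = z.1 - ⟪e 0, y - o⟫ := by
          simp only [hpt, inner_sub_right, inner_add_right, inner_smul_right, he00, he01]
          ring
        have hc1 : ⟪e 1, pt z - y⟫ = z.2 - ⟪e 1, y - o⟫ := by
          simp only [hpt, inner_sub_right, inner_add_right, inner_smul_right, he10, he11]
          ring
        rw [hc0, hc1] at hin
        rw [← hin]
        simp only [hHdef, hcoord]
        simp only [inner_sub_left, inner_sub_right] at hxz ⊢
        linarith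
      obtain ⟨b1, b2, b3⟩ := subgradient_bounds hl hD hzero hq0 hmono hq hh (by linarith)
        (abs_le.2 ⟨by linarith, by linarith⟩) h3 h4 hsub
      have c0 : ⟪e 0, x - x₀⟫ = ⟪e 0, x - ξ⟫ := by
        simp only [hx₀, inner_sub_right, inner_add_right, inner_smul_right, he01]; ring
      have c1 : ⟪e 1, x - x₀⟫ = ⟪e 1, x - ξ⟫ - s := by
        simp only [hx₀, inner_sub_right, inner_add_right, inner_smul_right, he11]; ring
      exact ⟨by rw [c0]; exact abs_le.1 b1, by rw [c1]; exact ⟨b2, b3⟩⟩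
  have hball : ∀ h, 0 < h → 8 * h ≤ T₁ → Box h ⊆ closedBall x₀ (C₁ * q (8 * h)) := by
    rintro h hh hhT x ⟨⟨h1, h2⟩, h3, h4⟩
    have k0 : 0 ≤ q (4 * h) := hq0 _ (by linarith) (by linarith)
    have k1 : q (4 * h) ≤ q (8 * h) := hmono _ _ (by linarith) (by linarith) (by linarith)
    have k2 : 0 ≤ q (h / 2) := hq0 _ (by linarith) (by linarith)
    have k3 : 8 / l * h * q (4 * h) ≤ 8 / l * T * q (8 * h) := by
      have : h ≤ T := by linarith
      gcongr
    have k4 : 0 ≤ 8 / l * h * q (4 * h) := by positivity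
    rw [mem_closedBall_iff_norm]
    refine le_of_sq_le_sq ?_ (mul_nonneg hC₁pos.le (k0.trans k1))
    rw [norm_sq_frame e, hC₁]
    have k5 := sq_le_sq' h1 h2
    have k6 : ⟪e 1, x - x₀⟫ ^ 2 ≤ (2 * q (8 * h)) ^ 2 := sq_le_sq' (by linarith) h4
    have k7 : (8 / l * h * q (4 * h)) ^ 2 ≤ (8 / l * T * q (8 * h)) ^ 2 := by gcongr
    have k8 : 0 ≤ (8 / l * T * q (8 * h)) * (2 * q (8 * h)) :=
      mul_nonneg (k4.trans k3) (by linarith)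
    have k9 : ((8 / l * T + 2) * q (8 * h)) ^ 2 = (8 / l * T * q (8 * h)) ^ 2 +
        (2 * q (8 * h)) ^ 2 + 2 * ((8 / l * T * q (8 * h)) * (2 * q (8 * h))) := by ring
    rw [k9]
    linarith
  have hsmall : ∀ h, 0 < h → 8 * h ≤ T₁ → C₁ * q (8 * h) ≤ ρ₀ := by
    intro h hh hhT
    have := hmono (8 * h) T₁ (by linarith) hhT hT₁T
    rw [lt_div_iff₀ hC₁pos] at hqT₁
    nlinarith
  have hlow : ∀ t, 0 < t → t ≤ T₁ → lam * l / (16 * C * C₁) * t ≤ q t := by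
    intro t ht htT
    have e8 : 8 * (t / 8) = t := by ring
    have h1 := hmass (t / 8) (by positivity) (by linarith)
    have h2 := hball (t / 8) (by positivity) (by linarith)
    have h3 := hsmall (t / 8) (by positivity) (by linarith)
    rw [e8] at h2 h3
    have h0 := hq0 t ht (by linarith)
    have h4 := (h1.trans (measure_mono h2)).trans (hνball _ (by positivity) h3)
    rw [ENNReal.ofReal_le_ofReal_iff (by positivity)] at h4
    rw [div_mul_eq_mul_div, div_le_iff₀ (by positivity)]
    nlinarith
  refine not_quadratic_decay (q := q) (T := T₁) (c := lam * l / (16 * C * C₁))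
    (C := 64 * C / (lam * l ^ 2)) (by positivity) (by positivity)
    (fun t t' h0 h1 h2 => hmono t t' h0 h1 (by linarith)) ?_ hlow ?_
  · intro ε hε
    obtain ⟨t, ht0, htT, hqt⟩ := hlim ε hε
    exact ⟨min t T₁, lt_min ht0 hT₁, min_le_right _ _,
      (hmono _ _ (lt_min ht0 hT₁) (min_le_left _ _) htT).trans_lt hqt⟩
  · intro t ht htT
    obtain ⟨h, rfl⟩ : ∃ h, t = 8 * h := ⟨t / 8, by ring⟩
    have hh : 0 < h := by linarith
    have e16 : 8 * h / 16 = h / 2 := by ring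
    rw [e16]
    have hα : 0 < q (h / 2) :=
      lt_of_lt_of_le (by positivity) (hlow (h / 2) (by positivity) (by linarith))
    have h4 : q (4 * h) ≤ q (8 * h) := hmono _ _ (by linarith) (by linarith) (by linarith)
    have h40 : 0 ≤ q (4 * h) := hq0 _ (by linarith) (by linarith)
    have h80 : 0 ≤ q (8 * h) := h40.trans h4
    have h1 := (hmass h hh htT).trans (hνfar (q (h / 2)) (Box h) hα (measurableSet_frameBox ..)
      ((hball h hh htT).trans (closedBall_subset_closedBall (hsmall h hh htT))) (by
        rintro x ⟨-, h3, -⟩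
        refine le_of_sq_le_sq ?_ (norm_nonneg _)
        rw [norm_sq_frame e]
        nlinarith [sq_nonneg ⟪e 0, x - x₀⟫]))
    have h41 : 0 ≤ 8 / l * h * q (4 * h) := by positivity
    rw [hBox, volume_frameBox, ← ENNReal.ofReal_mul (by linarith),
      ← ENNReal.ofReal_mul (by positivity)] at h1
    have h2 : C / q (h / 2) * ((8 / l * h * q (4 * h) - -(8 / l * h * q (4 * h))) *
        (2 * q (8 * h) - q (h / 2))) ≤
        C / q (h / 2) * ((2 * (8 / l * h * q (8 * h))) * (2 * q (8 * h))) := by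
      have k1 : 8 / l * h * q (4 * h) ≤ 8 / l * h * q (8 * h) := by gcongr
      have k2 : 0 ≤ 8 / l * h * q (4 * h) := by positivity
      refine mul_le_mul_of_nonneg_left ?_ (by positivity)
      refine (mul_le_mul_of_nonneg_left (show 2 * q (8 * h) - q (h / 2) ≤ 2 * q (8 * h) by linarith)
        (by linarith)).trans (mul_le_mul_of_nonneg_right (by linarith) (by linarith))
    have h3 := h1.trans (ENNReal.ofReal_le_ofReal h2)
    rw [ENNReal.ofReal_le_ofReal_iff (by positivity)] at h3
    have h5 : C / q (h / 2) * ((2 * (8 / l * h * q (8 * h))) * (2 * q (8 * h))) =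
        (32 * C / l * q (8 * h) ^ 2 * h) / q (h / 2) := by field_simp; ring
    rw [h5, le_div_iff₀ hα] at h3
    have h6 : (lam * (l / 2) * q (h / 2)) * h ≤ (32 * C / l * q (8 * h) ^ 2) * h := by linarith
    have h7 := le_of_mul_le_mul_right h6 hh
    have h8 : 64 * C / (lam * l ^ 2) * q (8 * h) ^ 2 =
        (32 * C / l * q (8 * h) ^ 2) / (lam * (l / 2)) := by field_simp; ring
    rw [h8, le_div_iff₀ (by positivity)]
    linarith

theorem invDistBound_of_le {ν : Measure (EuclideanSpace ℝ (Fin 2))}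
    {x₀ : EuclideanSpace ℝ (Fin 2)} {ρ₀ M : ℝ} (hρ₀ : 0 < ρ₀) (hM : 0 ≤ M)
    (h : ∀ B, MeasurableSet B → B ⊆ closedBall x₀ ρ₀ → ν B ≤ ENNReal.ofReal M * volume B) :
    InvDistBound ν x₀ := by
  have hπ := Real.pi_pos
  refine ⟨M * (Real.pi + 1) * ρ₀ + 1, by positivity, ρ₀, hρ₀, ?_, ?_⟩
  · intro ρ hρ hρρ
    refine (h _ measurableSet_closedBall (closedBall_subset_closedBall hρρ)).trans ?_
    rw [EuclideanSpace.volume_closedBall_fin_two, ← ENNReal.ofReal_pow hρ,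
      ← NNReal.coe_real_pi, ENNReal.ofReal_coe_nnreal, ← ENNReal.ofReal_coe_nnreal,
      NNReal.coe_real_pi, ← ENNReal.ofReal_mul (by positivity), ← ENNReal.ofReal_mul hM]
    refine ENNReal.ofReal_le_ofReal ?_
    have : M * (ρ ^ 2 * Real.pi) ≤ M * (ρ * ρ₀ * Real.pi) := by
      rw [sq]; gcongr
    have h2 : 0 ≤ M * ρ₀ * ρ := by positivity
    nlinarith
  · intro α B hα hB hBs hfar
    rcases B.eq_empty_or_nonempty with rfl | ⟨x, hx⟩
    · simp
    · refine (h B hB hBs).trans ?_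
      gcongr
      have h1 : α ≤ ρ₀ := (hfar x hx).trans (mem_closedBall_iff_norm.1 (hBs hx))
      rw [le_div_iff₀ hα]
      have : M * α ≤ M * ρ₀ := by gcongr
      have : 0 ≤ M * Real.pi * ρ₀ := by positivity
      nlinarith

theorem sphereArea_inv_nonneg (d : ℕ) : 0 ≤ (sphereArea d)⁻¹ :=
  inv_nonneg.2 ENNReal.toReal_nonneg

theorem unifBall_le {α : ℝ} {B : Set (EuclideanSpace ℝ (Fin 2))} (hα : 0 < α)
    (hB : MeasurableSet B) (h : ∀ x ∈ B, α ≤ ‖x‖) :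
    unifBall 2 B ≤ ENNReal.ofReal ((sphereArea 2)⁻¹ / α) * volume B := by
  rw [unifBall, withDensity_apply _ hB, ← setLIntegral_const]
  refine setLIntegral_mono' hB fun x hx => ?_
  refine (indicator_le_self' (fun _ _ => zero_le) x).trans (ENNReal.ofReal_le_ofReal ?_)
  have := h x hx
  have := sphereArea_inv_nonneg 2
  simp only [uDens, Nat.reduceSub, pow_one]
  gcongr

theorem le_unifBall {A : Set (EuclideanSpace ℝ (Fin 2))} (hA : MeasurableSet A)
    (h : A ⊆ ball 0 1) : ENNReal.ofReal (sphereArea 2)⁻¹ * volume A ≤ unifBall 2 A := by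
  rw [unifBall, withDensity_apply _ hA, ← setLIntegral_const]
  refine lintegral_mono_ae ?_
  have h0 : ∀ᵐ x : EuclideanSpace ℝ (Fin 2) ∂volume, x ≠ 0 := by
    simp [ae_iff]
  filter_upwards [ae_restrict_mem hA, ae_restrict_of_ae h0] with x hx hx0
  rw [indicator_of_mem (h hx)]
  refine ENNReal.ofReal_le_ofReal ?_
  simp only [uDens, Nat.reduceSub, pow_one]
  rw [le_div_iff₀ (norm_pos_iff.2 hx0)]
  have h1 : ‖x‖ ≤ 1 := (mem_ball_zero_iff.1 (h hx)).le
  exact mul_le_of_le_one_right (sphereArea_inv_nonneg 2) h1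

theorem unifBall_closedBall_le : ∃ C : ℝ, 0 ≤ C ∧ ∀ ρ : ℝ, 0 ≤ ρ →
    unifBall 2 (closedBall 0 ρ) ≤ ENNReal.ofReal (C * ρ) := by
  set c := (sphereArea 2)⁻¹ with hc
  have hc0 : 0 ≤ c := sphereArea_inv_nonneg 2
  refine ⟨2 * (volume.real (ball (0 : EuclideanSpace ℝ (Fin 2)) 1) * c), by positivity, ?_⟩
  intro ρ hρ
  set f : ℝ → ℝ := (Iic ρ).indicator fun y => c / y with hf
  have hf0 : ∀ x : EuclideanSpace ℝ (Fin 2), 0 ≤ f ‖x‖ := fun x => by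
    have : 0 ≤ c / ‖x‖ := by positivity
    simp only [hf, indicator_apply]
    split_ifs <;> simp [this]
  have hpow : EqOn (fun y : ℝ => y ^ (Module.finrank ℝ (EuclideanSpace ℝ (Fin 2)) - 1) • f y)
      ((Iic ρ).indicator fun _ => c) (Ioi 0) := by
    intro y hy
    have hy' : y ≠ 0 := (mem_Ioi.1 hy).ne'
    by_cases hyρ : y ≤ ρ
    · simp [hf, hyρ]; field_simp
    · simp [hf, hyρ]
  have hint : Integrable (fun x : EuclideanSpace ℝ (Fin 2) => f ‖x‖) := by
    rw [integrable_fun_norm_addHaar, integrableOn_congr_fun hpow measurableSet_Ioi,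
      IntegrableOn, integrable_indicator_iff measurableSet_Iic, IntegrableOn,
      Measure.restrict_restrict measurableSet_Iic]
    refine integrableOn_const ?_
    rw [inter_comm, Ioi_inter_Iic]
    simp
  calc unifBall 2 (closedBall 0 ρ) ≤ ∫⁻ x : EuclideanSpace ℝ (Fin 2), ENNReal.ofReal (f ‖x‖) := by
        rw [unifBall, withDensity_apply _ measurableSet_closedBall,
          ← lintegral_indicator measurableSet_closedBall]
        refine lintegral_mono fun x => ?_
        by_cases hx : x ∈ closedBall (0 : EuclideanSpace ℝ (Fin 2)) ρ
        · rw [indicator_of_mem hx]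
          refine (indicator_le_self' (fun _ _ => zero_le) x).trans (ENNReal.ofReal_le_ofReal ?_)
          rw [hf, indicator_of_mem (by simpa using hx)]
          simp [uDens, hc]
        · rw [indicator_of_notMem hx]; exact zero_le
    _ = ENNReal.ofReal (∫ x : EuclideanSpace ℝ (Fin 2), f ‖x‖) :=
        (ofReal_integral_eq_lintegral_ofReal hint (.of_forall hf0)).symm
    _ = _ := by
        rw [integral_fun_norm_addHaar, setIntegral_congr_fun measurableSet_Ioi hpow,
          setIntegral_indicator measurableSet_Iic, Ioi_inter_Iic]
        simp only [finrank_euclideanSpace_fin, integral_const, MeasurableSet.univ,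
          measureReal_restrict_apply, univ_inter, Real.volume_real_Ioc, sub_zero, max_eq_left hρ,
          smul_eq_mul, nsmul_eq_mul, Nat.cast_ofNat]
        ring_nf

theorem invDistBound_unifBall (x₀ : EuclideanSpace ℝ (Fin 2)) : InvDistBound (unifBall 2) x₀ := by
  have hc0 : 0 ≤ (sphereArea 2)⁻¹ := sphereArea_inv_nonneg 2
  rcases eq_or_ne x₀ 0 with rfl | hx₀
  · obtain ⟨C, hC, hball⟩ := unifBall_closedBall_le
    refine ⟨C + (sphereArea 2)⁻¹ + 1, by positivity, 1, one_pos, ?_, ?_⟩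
    · intro ρ hρ _
      refine (hball ρ hρ).trans (ENNReal.ofReal_le_ofReal ?_)
      gcongr
      linarith
    · intro α B hα hB _ hfar
      refine (unifBall_le hα hB (by simpa using hfar)).trans ?_
      gcongr
      linarith
  · have hr : 0 < ‖x₀‖ / 2 := by have := norm_pos_iff.2 hx₀; positivity
    refine invDistBound_of_le hr (M := (sphereArea 2)⁻¹ / (‖x₀‖ / 2)) (by positivity) ?_
    intro B hB hBs
    refine unifBall_le hr hB fun x hx => ?_
    have h1 := mem_closedBall_iff_norm.1 (hBs hx)
    have h2 := norm_sub_norm_le x₀ x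
    rw [norm_sub_rev] at h2
    linarith

theorem mem_subgrad_of_hasGradientAt {Ω : Set (EuclideanSpace ℝ (Fin 2))}
    {F : EuclideanSpace ℝ (Fin 2) → ℝ} (hF : ConvexOn ℝ Ω F) {x q : EuclideanSpace ℝ (Fin 2)}
    (hx : x ∈ Ω) (h : HasGradientAt F q x) : q ∈ subgrad Ω F x := by
  intro z hz
  have hconv : ConvexOn ℝ (AffineMap.lineMap x z ⁻¹' Ω) (F ∘ AffineMap.lineMap (k := ℝ) x z) :=
    hF.comp_affineMap _
  have hline : HasDerivAt (AffineMap.lineMap (k := ℝ) x z) (z - x) 0 := by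
    simpa using AffineMap.hasDerivAt_lineMap
  have hder : HasDerivAt (F ∘ AffineMap.lineMap (k := ℝ) x z) ⟪q, z - x⟫ 0 := by
    have hg : HasFDerivAt F (InnerProductSpace.toDual ℝ _ q) (AffineMap.lineMap (k := ℝ) x z 0) := by
      simpa using h.hasFDerivAt
    simpa using hg.comp_hasDerivAt (0 : ℝ) hline
  have := hconv.le_slope_of_hasDerivAt (x := 0) (y := 1) (by simpa using hx) (by simpa using hz)
    one_pos hder
  simp [slope_def_field] at this
  linarith

theorem subgrad_monotone {Ω : Set (EuclideanSpace ℝ (Fin 2))} {F : EuclideanSpace ℝ (Fin 2) → ℝ}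
    {x x' y y' : EuclideanSpace ℝ (Fin 2)} (hx : x ∈ Ω) (hx' : x' ∈ Ω) (hy : y ∈ subgrad Ω F x)
    (hy' : y' ∈ subgrad Ω F x') : 0 ≤ ⟪x' - x, y' - y⟫ := by
  have h1 := hy x' hx'
  have h2 := hy' x hx
  rw [← neg_sub x' x, inner_neg_right] at h2
  rw [real_inner_comm, inner_sub_left]
  linarith

theorem mem_subgrad_of_tendsto {Ω : Set (EuclideanSpace ℝ (Fin 2))}
    {F : EuclideanSpace ℝ (Fin 2) → ℝ} {ι : Type*} {f : Filter ι} [f.NeBot]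
    {x y : ι → EuclideanSpace ℝ (Fin 2)} {x₀ y₀ : EuclideanSpace ℝ (Fin 2)}
    (hF : ContinuousAt F x₀) (hx : Filter.Tendsto x f (nhds x₀))
    (hy : Filter.Tendsto y f (nhds y₀)) (h : ∀ᶠ i in f, y i ∈ subgrad Ω F (x i)) :
    y₀ ∈ subgrad Ω F x₀ := by
  intro z hz
  have ht : Filter.Tendsto (fun i => F (x i) + ⟪y i, z - x i⟫) f (nhds (F x₀ + ⟪y₀, z - x₀⟫)) :=
    (hF.tendsto.comp hx).add (hy.inner (tendsto_const_nhds.sub hx))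
  exact le_of_tendsto ht (h.mono fun i hi => hi z hz)

theorem subgrad_locally_bounded {Ω : Set (EuclideanSpace ℝ (Fin 2))} (hΩ : IsOpen Ω)
    {F : EuclideanSpace ℝ (Fin 2) → ℝ} {x₀ : EuclideanSpace ℝ (Fin 2)} (hx₀ : x₀ ∈ Ω)
    (hF : ContinuousAt F x₀) :
    ∃ M : ℝ, ∀ᶠ x in nhds x₀, subgrad Ω F x ⊆ closedBall 0 M := by
  have h1 : ∀ᶠ x in nhds x₀, x ∈ Ω ∧ |F x - F x₀| < 1 :=
    (hΩ.eventually_mem hx₀).and (hF.eventually (eventually_abs_sub_lt (F x₀) one_pos))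
  obtain ⟨r, hr, hball⟩ := Metric.eventually_nhds_iff_ball.1 h1
  refine ⟨2 / (r / 2), ?_⟩
  filter_upwards [ball_mem_nhds x₀ (half_pos hr)] with x hx y hy
  rw [mem_closedBall_zero_iff]
  rcases eq_or_ne y 0 with rfl | hy0
  · simp only [norm_zero]; positivity
  have hny : 0 < ‖y‖ := norm_pos_iff.2 hy0
  set z := x + ((r / 2) / ‖y‖) • y with hz
  have hzx : ‖z - x‖ = r / 2 := by
    rw [hz, add_sub_cancel_left, norm_smul, norm_div, norm_norm, div_mul_cancel₀ _ hny.ne',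
      Real.norm_of_nonneg (by positivity)]
  have hzb : z ∈ ball x₀ r := by
    rw [mem_ball, dist_eq_norm]
    rw [mem_ball, dist_eq_norm] at hx
    calc ‖z - x₀‖ = ‖(z - x) + (x - x₀)‖ := by simp
      _ ≤ ‖z - x‖ + ‖x - x₀‖ := norm_add_le _ _
      _ < r := by linarith
  have k1 := hball z hzb
  have k2 := hball x (ball_subset_ball (by linarith) hx)
  have k3 := hy z k1.1
  have k4 : ⟪y, z - x⟫ = r / 2 * ‖y‖ := by
    rw [hz, add_sub_cancel_left, inner_smul_right, real_inner_self_eq_norm_sq]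
    field_simp
  rw [le_div_iff₀ (by positivity)]
  have k5 := abs_lt.1 k1.2
  have k6 := abs_lt.1 k2.2
  linarith

/-- A monotone relation transporting `unifBall 2` to a measure with locally positive density cannot
be extended monotonically to a boundary point of the ball. -/
theorem not_monotone_at_boundary {P : Measure (EuclideanSpace ℝ (Fin 2))}
    (hP : ∀ R : ℝ, 0 < R → ∃ lam : ℝ, 0 < lam ∧ ∀ A : Set (EuclideanSpace ℝ (Fin 2)),
      MeasurableSet A → A ⊆ ball 0 R → ENNReal.ofReal lam * volume A ≤ P A)
    {G : EuclideanSpace ℝ (Fin 2) → Set (EuclideanSpace ℝ (Fin 2))}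
    (hG : ∀ A B : Set (EuclideanSpace ℝ (Fin 2)), MeasurableSet A → MeasurableSet B →
      (∀ x ∈ ball 0 1, ∀ y ∈ G x, y ∈ A → x ∈ B) → P A ≤ unifBall 2 B)
    {x₀ y₀ : EuclideanSpace ℝ (Fin 2)} (hx₀ : ‖x₀‖ = 1)
    (hmon : ∀ x ∈ ball (0 : EuclideanSpace ℝ (Fin 2)) 1, ∀ y ∈ G x, 0 ≤ ⟪x - x₀, y - y₀⟫) :
    False := by
  obtain ⟨e, he⟩ := exists_frame hx₀
  obtain ⟨lam, hlam, hPA⟩ := hP (‖y₀‖ + 4) (by positivity)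
  set c := (sphereArea 2)⁻¹ with hc
  have hc0 : 0 ≤ c := sphereArea_inv_nonneg 2
  have he00 : ⟪e 0, e 0⟫ = (1 : ℝ) := by simp
  have he10 : ⟪e 1, e 0⟫ = (0 : ℝ) := e.orthonormal.2 (by decide)
  have key : ∀ ε : ℝ, 0 < ε → ε ≤ 1 / 2 → lam * (2 * ε) ≤ c / (1 / 2) * (2 * ε ^ 2 * (4 * ε)) := by
    intro ε hε hε1
    have h1 := hPA (frameBox e y₀ 1 2 (-ε) ε) (measurableSet_frameBox ..) (by
      rintro y ⟨⟨a1, a2⟩, a3, a4⟩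
      have hn := norm_sq_frame e (y - y₀)
      have hlt : ‖y - y₀‖ < 4 := by
        refine lt_of_pow_lt_pow_left₀ 2 (by positivity) ?_
        rw [hn]
        nlinarith
      rw [mem_ball_zero_iff]
      calc ‖y‖ = ‖y₀ + (y - y₀)‖ := by simp
        _ ≤ ‖y₀‖ + ‖y - y₀‖ := norm_add_le _ _
        _ < ‖y₀‖ + 4 := by linarith)
    have h2 := hG (frameBox e y₀ 1 2 (-ε) ε) (frameBox e 0 (1 - 2 * ε ^ 2) 1 (-(2 * ε)) (2 * ε))
      (measurableSet_frameBox ..) (measurableSet_frameBox ..) (by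
      rintro x hx y hy ⟨⟨a1, a2⟩, a3, a4⟩
      have hm := hmon x hx y hy
      have hn := norm_sq_frame e x
      have hx1 : ‖x‖ ^ 2 < 1 := by
        have := mem_ball_zero_iff.1 hx
        nlinarith [norm_nonneg x]
      rw [inner_frame e] at hm
      have d0 : ⟪e 0, x - x₀⟫ = ⟪e 0, x⟫ - 1 := by rw [inner_sub_right, ← he, he00]
      have d1 : ⟪e 1, x - x₀⟫ = ⟪e 1, x⟫ := by rw [inner_sub_right, ← he, he10, sub_zero]
      rw [d0, d1] at hm
      simp only [frameBox, sub_zero, mem_ofPred_eq, mem_Icc]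
      generalize ⟪e 0, x⟫ = X at *
      generalize ⟪e 1, x⟫ = Y at *
      generalize ⟪e 0, y - y₀⟫ = s at *
      generalize ⟪e 1, y - y₀⟫ = t at *
      have hX : X ≤ 1 := by nlinarith
      have hX' : -1 ≤ X := by nlinarith
      have f1 : Y * t ≤ |Y| * ε := by
        calc Y * t ≤ |Y * t| := le_abs_self _
          _ = |Y| * |t| := abs_mul _ _
          _ ≤ |Y| * ε := by gcongr; exact abs_le.2 ⟨a3, a4⟩
      have f2 : 1 - X ≤ |Y| * ε := by nlinarith
      have f3 : |Y| * |Y| ≤ |Y| * (2 * ε) := by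
        rw [abs_mul_abs_self]; nlinarith
      have f4 : |Y| ≤ 2 * ε := by
        rcases (abs_nonneg Y).eq_or_lt with h | h
        · rw [← h]; positivity
        · exact le_of_mul_le_mul_left f3 h
      refine ⟨⟨?_, hX⟩, abs_le.1 f4⟩
      nlinarith)
    have h3 := unifBall_le (α := 1 / 2) (B := frameBox e 0 (1 - 2 * ε ^ 2) 1 (-(2 * ε)) (2 * ε))
      (by norm_num) (measurableSet_frameBox ..) (by
      rintro x ⟨⟨a1, -⟩, -⟩
      rw [sub_zero] at a1
      refine le_of_sq_le_sq ?_ (norm_nonneg _)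
      rw [norm_sq_frame e x]
      have a2 : 1 / 2 ≤ ⟪e 0, x⟫ := by nlinarith
      nlinarith [sq_nonneg ⟪e 1, x⟫])
    have h4 := (h1.trans h2).trans h3
    rw [volume_frameBox, volume_frameBox, ← ENNReal.ofReal_mul (by norm_num),
      ← ENNReal.ofReal_mul hlam.le, ← ENNReal.ofReal_mul (by nlinarith),
      ← ENNReal.ofReal_mul (by positivity), ENNReal.ofReal_le_ofReal_iff (by
        refine mul_nonneg (by positivity) (mul_nonneg ?_ ?_) <;> nlinarith)] at h4
    nlinarith
  obtain ⟨ε, hε, hε1, hε2⟩ : ∃ ε : ℝ, 0 < ε ∧ ε ≤ 1 / 2 ∧ 8 * c * ε < lam := by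
    refine ⟨min (1 / 2) (lam / (8 * c + 1) / 2), lt_min (by norm_num) (by positivity),
      min_le_left _ _, ?_⟩
    calc 8 * c * min (1 / 2) (lam / (8 * c + 1) / 2) ≤ (8 * c + 1) * (lam / (8 * c + 1) / 2) := by
          gcongr
          · linarith
          · exact min_le_right _ _
      _ = lam / 2 := by field_simp
      _ < lam := by linarith
  have h1 := key ε hε hε1
  have h2 : lam * (2 * ε) ≤ (8 * c * ε ^ 2) * (2 * ε) := by nlinarith
  have h3 := le_of_mul_le_mul_right h2 (by positivity)
  nlinarith [mul_nonneg hc0 hε.le]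

theorem exists_tendsto_of_bounded {ι : Type*} {f : Filter ι} [f.NeBot]
    {u : ι → EuclideanSpace ℝ (Fin 2)} {M : ℝ} (h : ∀ᶠ i in f, u i ∈ closedBall 0 M) :
    ∃ g : Filter ι, g ≤ f ∧ g.NeBot ∧ ∃ y, Filter.Tendsto u g (nhds y) := by
  have hle : ((Ultrafilter.of f).map u : Filter (EuclideanSpace ℝ (Fin 2))) ≤
      Filter.principal (closedBall 0 M) := by
    rw [Filter.le_principal_iff]
    exact Ultrafilter.of_le f h
  obtain ⟨y, -, hy⟩ := (isCompact_closedBall _ M).ultrafilter_le_nhds _ hle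
  exact ⟨Ultrafilter.of f, Ultrafilter.of_le f, inferInstance, y, hy⟩

theorem tendsto_of_bounded_of_unique_limit {ι : Type*} {f : Filter ι}
    {u : ι → EuclideanSpace ℝ (Fin 2)} {M : ℝ} {y₀ : EuclideanSpace ℝ (Fin 2)}
    (h : ∀ᶠ i in f, u i ∈ closedBall 0 M)
    (huniq : ∀ (g : Filter ι) (y : EuclideanSpace ℝ (Fin 2)), g ≤ f → g.NeBot →
      Filter.Tendsto u g (nhds y) → y = y₀) : Filter.Tendsto u f (nhds y₀) := by
  refine (isCompact_closedBall _ M).tendsto_nhds_of_unique_mapClusterPt h fun y _ hy => ?_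
  obtain ⟨g, hg, hgy⟩ := mapClusterPt_iff_ultrafilter.1 hy
  exact huniq g y hg inferInstance hgy

theorem hasGradientAt_of_continuousAt_subgrad {Ω : Set (EuclideanSpace ℝ (Fin 2))}
    (hΩ : IsOpen Ω) {F : EuclideanSpace ℝ (Fin 2) → ℝ}
    {T : EuclideanSpace ℝ (Fin 2) → EuclideanSpace ℝ (Fin 2)}
    (hT : ∀ x ∈ Ω, T x ∈ subgrad Ω F x) {x : EuclideanSpace ℝ (Fin 2)} (hx : x ∈ Ω)
    (hc : ContinuousAt T x) : HasGradientAt F (T x) x := by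
  rw [hasGradientAt_iff_isLittleO, Asymptotics.isLittleO_iff]
  intro ε hε
  filter_upwards [hΩ.mem_nhds hx, hc.eventually (ball_mem_nhds _ hε)] with z hz hTz
  have h1 := hT x hx z hz
  have h2 := hT z hz x hx
  rw [← neg_sub z x, inner_neg_right] at h2
  have h3 : ⟪T z - T x, z - x⟫ ≤ ‖T z - T x‖ * ‖z - x‖ := real_inner_le_norm _ _
  rw [inner_sub_left] at h3
  have h4 : ‖T z - T x‖ * ‖z - x‖ ≤ ε * ‖z - x‖ := by
    gcongr
    exact (mem_ball_iff_norm.1 hTz).le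
  rw [Real.norm_of_nonneg (by linarith)]
  linarith

theorem convexOn_univ_of_subgrad {F : EuclideanSpace ℝ (Fin 2) → ℝ}
    (h : ∀ y, (subgrad univ F y).Nonempty) : ConvexOn ℝ univ F := by
  refine ⟨convex_univ, fun x _ y _ r s hr hs hrs => ?_⟩
  obtain ⟨q, hq⟩ := h (r • x + s • y)
  have h1 := mul_le_mul_of_nonneg_left (hq x (mem_univ _)) hr
  have h2 := mul_le_mul_of_nonneg_left (hq y (mem_univ _)) hs
  obtain rfl : s = 1 - r := by linarith
  simp only [inner_sub_right, inner_add_right, inner_smul_right, smul_eq_mul] at h1 h2 ⊢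
  linarith

/-- In dimension `d = 2`, `K = ∂φ(0)` is a single point and
`Q± = ∇φ` is a homeomorphism from `B_1` onto `ℝ²`. -/
theorem stmt4
    (p : EuclideanSpace ℝ (Fin 2) → ℝ)
    (P : Measure (EuclideanSpace ℝ (Fin 2))) [IsProbabilityMeasure P]
    (hP : P = volume.withDensity fun y => ENNReal.ofReal (p y))
    (hp : ∀ R : ℝ, 0 < R → ∃ lam Lam : ℝ, 0 < lam ∧ 0 < Lam ∧
      ∀ᵐ y ∂(volume : Measure (EuclideanSpace ℝ (Fin 2))),
        y ∈ ball (0 : EuclideanSpace ℝ (Fin 2)) R → lam ≤ p y ∧ p y ≤ Lam)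
    (φ : EuclideanSpace ℝ (Fin 2) → ℝ)
    (hφ : ConvexOn ℝ (ball (0 : EuclideanSpace ℝ (Fin 2)) 1) φ)
    (Q : EuclideanSpace ℝ (Fin 2) → EuclideanSpace ℝ (Fin 2))
    (hQmeas : Measurable Q)
    (hQgrad : ∀ᵐ x ∂(volume.restrict (ball (0 : EuclideanSpace ℝ (Fin 2)) 1)),
      HasGradientAt φ (Q x) x)
    (hpush : Measure.map Q (unifBall 2) = P)
    (K : Set (EuclideanSpace ℝ (Fin 2)))
    (hK : K = {q | ∀ z ∈ ball (0 : EuclideanSpace ℝ (Fin 2)) 1, φ 0 + ⟪q, z⟫ ≤ φ z}) :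
    (∃ y₀ : EuclideanSpace ℝ (Fin 2), K = {y₀}) ∧
    (∀ x ∈ ball (0 : EuclideanSpace ℝ (Fin 2)) 1, DifferentiableAt ℝ φ x) ∧
    ∃ H : (ball (0 : EuclideanSpace ℝ (Fin 2)) 1 : Set (EuclideanSpace ℝ (Fin 2))) ≃ₜ
        EuclideanSpace ℝ (Fin 2),
      ∀ x, H x = gradient φ (x : EuclideanSpace ℝ (Fin 2)) := by
  set Ω : Set (EuclideanSpace ℝ (Fin 2)) := ball 0 1 with hΩdef
  have hΩ : IsOpen Ω := isOpen_ball
  have hcont : ∀ x ∈ Ω, ContinuousAt φ x := fun x hx =>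
    (hφ.continuousOn hΩ).continuousAt (hΩ.mem_nhds hx)
  -- local two-sided bounds for `P`
  have hPlow : ∀ R : ℝ, 0 < R → ∃ lam : ℝ, 0 < lam ∧ ∀ A : Set (EuclideanSpace ℝ (Fin 2)),
      MeasurableSet A → A ⊆ ball 0 R → ENNReal.ofReal lam * volume A ≤ P A := by
    intro R hR
    obtain ⟨lam, Lam, hlam, -, h⟩ := hp R hR
    refine ⟨lam, hlam, fun A hA hAR => ?_⟩
    rw [hP, withDensity_apply _ hA, ← setLIntegral_const]
    refine lintegral_mono_ae ?_
    filter_upwards [ae_restrict_mem hA, ae_restrict_of_ae h] with y hy hy'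
    exact ENNReal.ofReal_le_ofReal (hy' (hAR hy)).1
  have hPinv : ∀ y₀, InvDistBound P y₀ := by
    intro y₀
    obtain ⟨lam, Lam, -, hLam, h⟩ := hp (‖y₀‖ + 2) (by positivity)
    refine invDistBound_of_le one_pos hLam.le fun B hB hBs => ?_
    rw [hP, withDensity_apply _ hB, ← setLIntegral_const]
    refine lintegral_mono_ae ?_
    filter_upwards [ae_restrict_mem hB, ae_restrict_of_ae h] with y hy hy'
    refine ENNReal.ofReal_le_ofReal (hy' ?_).2
    have h1 := mem_closedBall_iff_norm.1 (hBs hy)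
    have h2 := norm_sub_norm_le y y₀
    rw [mem_ball_zero_iff]
    linarith
  have hc : 0 < (sphereArea 2)⁻¹ := by
    refine lt_of_le_of_ne (sphereArea_inv_nonneg 2) fun h0 => ?_
    have hU : unifBall 2 = 0 := by
      have hz : uDens 2 = fun _ => 0 := by
        funext x
        simp [uDens, ← h0]
      simp [unifBall, hz]
    have h1 : P univ = 1 := measure_univ
    rw [← hpush, hU] at h1
    simp at h1
  -- `Q` is almost everywhere a subgradient, and transports mass accordingly
  have hae : ∀ᵐ x ∂(volume : Measure (EuclideanSpace ℝ (Fin 2))), x ∈ Ω → Q x ∈ subgrad Ω φ x := by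
    filter_upwards [(ae_restrict_iff' measurableSet_ball).1 hQgrad] with x hx hxΩ
    exact mem_subgrad_of_hasGradientAt hφ hxΩ (hx hxΩ)
  have hgood : ∀ᵐ x ∂(unifBall 2), x ∈ Ω ∧ Q x ∈ subgrad Ω φ x := by
    have h1 : ∀ᵐ x ∂(unifBall 2), x ∈ Ω := by
      rw [ae_iff]
      change unifBall 2 Ωᶜ = 0
      rw [unifBall, withDensity_apply _ measurableSet_ball.compl,
        setLIntegral_congr_fun measurableSet_ball.compl (g := fun _ => 0)
          fun x hx => indicator_of_notMem hx _]
      simp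
    have h2 := (withDensity_absolutelyContinuous volume ((ball (0 : EuclideanSpace ℝ (Fin 2))
      1).indicator fun x => ENNReal.ofReal (uDens 2 x))).ae_le hae
    filter_upwards [h1, h2] with x hx hx' using ⟨hx, hx' hx⟩
  have hPU : ∀ A B : Set (EuclideanSpace ℝ (Fin 2)), MeasurableSet A → MeasurableSet B →
      (∀ x ∈ ball 0 1, ∀ y ∈ subgrad Ω φ x, y ∈ A → x ∈ B) → P A ≤ unifBall 2 B := by
    intro A B hA hB h
    rw [← hpush, Measure.map_apply hQmeas hA]
    refine measure_mono_ae ?_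
    filter_upwards [hgood] with x hx hxA using h x hx.1 _ hx.2 hxA
  have hUP : ∀ A B : Set (EuclideanSpace ℝ (Fin 2)), MeasurableSet A → MeasurableSet B →
      (∀ x ∈ A, subgrad Ω φ x ⊆ B) → unifBall 2 A ≤ P B := by
    intro A B hA hB h
    rw [← hpush, Measure.map_apply hQmeas hB]
    refine measure_mono_ae ?_
    filter_upwards [hgood] with x hx hxA using h x hxA hx.2
  -- the graph of the subdifferential is closed, up to and including the boundary of the ball
  have hclosed : ∀ {f : Filter (EuclideanSpace ℝ (Fin 2))} {u v : EuclideanSpace ℝ (Fin 2) →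
      EuclideanSpace ℝ (Fin 2)} {x₀ y₀ : EuclideanSpace ℝ (Fin 2)}, f.NeBot →
      Filter.Tendsto u f (nhds x₀) → Filter.Tendsto v f (nhds y₀) →
      (∀ᶠ i in f, u i ∈ Ω ∧ v i ∈ subgrad Ω φ (u i)) → x₀ ∈ Ω ∧ y₀ ∈ subgrad Ω φ x₀ := by
    intro f u v x₀ y₀ hf hu hv h
    have hx₀ : x₀ ∈ Ω := by
      have hle : ‖x₀‖ ≤ 1 := le_of_tendsto hu.norm
        (h.mono fun i hi => (mem_ball_zero_iff.1 hi.1).le)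
      rw [hΩdef, mem_ball_zero_iff]
      refine lt_of_le_of_ne hle fun h1 => ?_
      refine not_monotone_at_boundary hPlow hPU h1 (y₀ := y₀) fun x hx y hy => ?_
      exact ge_of_tendsto ((tendsto_const_nhds.sub hu).inner (tendsto_const_nhds.sub hv))
        (h.mono fun i hi => subgrad_monotone hi.1 hx hi.2 hy)
    exact ⟨hx₀, mem_subgrad_of_tendsto (hcont x₀ hx₀) hu hv (h.mono fun i hi => hi.2)⟩
  have hex : ∀ x, ∃ y, x ∈ Ω → y ∈ subgrad Ω φ x := by
    intro x
    by_cases hx : x ∈ Ω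
    swap
    · exact ⟨0, fun h => absurd h hx⟩
    have hne : (nhdsWithin x {x | x ∈ Ω → Q x ∈ subgrad Ω φ x}).NeBot :=
      mem_closure_iff_nhdsWithin_neBot.1 (Measure.dense_of_ae hae x)
    obtain ⟨M, hM⟩ := subgrad_locally_bounded hΩ hx (hcont x hx)
    have hev : ∀ᶠ z in nhdsWithin x {x | x ∈ Ω → Q x ∈ subgrad Ω φ x},
        z ∈ Ω ∧ Q z ∈ subgrad Ω φ z := by
      filter_upwards [self_mem_nhdsWithin, nhdsWithin_le_nhds (hΩ.mem_nhds hx)] with z h1 h2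
      exact ⟨h2, h1 h2⟩
    obtain ⟨g, hg, hgne, y, hy⟩ := exists_tendsto_of_bounded (u := Q) (M := M) (by
      filter_upwards [hev, nhdsWithin_le_nhds hM] with z h1 h2 using h2 h1.2)
    exact ⟨y, fun _ => (hclosed hgne (Filter.tendsto_id.mono_left (hg.trans nhdsWithin_le_nhds)) hy
      (hg hev)).2⟩
  have hsurj : ∀ y, ∃ x, x ∈ Ω ∧ y ∈ subgrad Ω φ x := by
    set S := {y | ∃ x, x ∈ Ω ∧ y ∈ subgrad Ω φ x} with hS
    have hdense : Dense S := by
      intro y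
      rw [Metric.mem_closure_iff]
      intro r hr
      by_contra! hcon
      obtain ⟨lam, hlam, hA⟩ := hPlow (‖y‖ + r) (by positivity)
      have h1 := hA (ball y r) measurableSet_ball (ball_subset_ball' (by simp [add_comm]))
      have h2 := hPU (ball y r) ∅ measurableSet_ball MeasurableSet.empty fun x hx z hz hzr =>
        absurd (hcon z ⟨x, hx, hz⟩) (by rw [dist_comm]; exact not_le.2 hzr)
      rw [measure_empty] at h2
      have h3 : 0 < ENNReal.ofReal lam * volume (ball y r) :=
        ENNReal.mul_pos (by simpa using hlam) (measure_ball_pos volume y hr).ne'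
      exact absurd (h1.trans h2) (not_le.2 h3)
    have hch : ∀ y, ∃ x, y ∈ S → x ∈ Ω ∧ y ∈ subgrad Ω φ x := fun y => by
      by_cases hy : y ∈ S
      · exact ⟨hy.choose, fun _ => hy.choose_spec⟩
      · exact ⟨0, fun h => absurd h hy⟩
    choose u hu using hch
    intro y
    have hne : (nhdsWithin y S).NeBot := mem_closure_iff_nhdsWithin_neBot.1 (hdense y)
    have hev : ∀ᶠ z in nhdsWithin y S, u z ∈ Ω ∧ z ∈ subgrad Ω φ (u z) := by
      filter_upwards [self_mem_nhdsWithin] with z hz using hu z hz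
    obtain ⟨g, hg, hgne, x, hx⟩ := exists_tendsto_of_bounded (u := u) (M := 1)
      (hev.mono fun z hz => ball_subset_closedBall hz.1)
    exact ⟨x, hclosed hgne hx (Filter.tendsto_id.mono_left (hg.trans nhdsWithin_le_nhds)) (hg hev)⟩
  choose T hT using hex
  choose g hgΩ hg using hsurj
  -- strict convexity of `φ`
  have hinj : ∀ x ∈ Ω, ∀ x' ∈ Ω, ∀ y ∈ subgrad Ω φ x, y ∈ subgrad Ω φ x' → x = x' := by
    intro x hx x' hx' y hy hy'
    refine eq_of_common_subgradient hΩ hφ P (fun R _ => ⟨_, hc, fun A B hA hB hAΩ _ h => ?_⟩)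
      hPinv hx hx' hy hy'
    exact (le_unifBall hA hAΩ).trans (hUP A B hA hB h)
  -- strict convexity of the conjugate of `φ`
  have huniq : ∀ x ∈ Ω, ∀ y ∈ subgrad Ω φ x, ∀ y' ∈ subgrad Ω φ x, y = y' := by
    set ψ : EuclideanSpace ℝ (Fin 2) → ℝ := fun y => ⟪g y, y⟫ - φ (g y) with hψ
    have hdual : ∀ x ∈ Ω, ∀ y ∈ subgrad Ω φ x, x ∈ subgrad univ ψ y := by
      intro x hx y hy z _
      have h1 := hy (g y) (hgΩ y)
      have h2 := hg z x hx
      simp only [hψ, inner_sub_right] at h1 h2 ⊢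
      rw [real_inner_comm (g y) y] at *
      rw [real_inner_comm (g z) z] at *
      rw [real_inner_comm x z] at *
      rw [real_inner_comm x y] at *
      linarith
    intro x hx y hy y' hy'
    refine eq_of_common_subgradient isOpen_univ
      (convexOn_univ_of_subgrad fun y => ⟨g y, hdual _ (hgΩ y) _ (hg y)⟩) (unifBall 2) ?_
      invDistBound_unifBall (mem_univ y) (mem_univ y') (hdual x hx y hy) (hdual x hx y' hy')
    intro R hR
    obtain ⟨lam, hlam, h⟩ := hPlow R hR
    exact ⟨lam, hlam, fun A B hA hB _ hAR hAB => (h A hA hAR).trans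
      (hPU A B hA hB fun x hx y hy hyA => hAB y hyA (hdual x hx y hy))⟩
  have hTcont : ∀ x ∈ Ω, ContinuousAt T x := by
    intro x hx
    obtain ⟨M, hM⟩ := subgrad_locally_bounded hΩ hx (hcont x hx)
    have hev : ∀ᶠ z in nhds x, z ∈ Ω ∧ T z ∈ subgrad Ω φ z :=
      (hΩ.eventually_mem hx).mono fun z hz => ⟨hz, hT z hz⟩
    refine tendsto_of_bounded_of_unique_limit (M := M) ?_ fun f y hf hne hy => ?_
    · filter_upwards [hev, hM] with z h1 h2 using h2 h1.2
    · exact huniq x hx y (hclosed hne (Filter.tendsto_id.mono_left hf) hy (hf hev)).2 _ (hT x hx)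
  have hgcont : Continuous g := by
    rw [continuous_iff_continuousAt]
    intro y
    refine tendsto_of_bounded_of_unique_limit (M := 1)
      (.of_forall fun z => ball_subset_closedBall (hgΩ z)) fun f x hf hne hx => ?_
    have := hclosed hne hx (Filter.tendsto_id.mono_left hf) (.of_forall fun z => ⟨hgΩ z, hg z⟩)
    exact hinj x this.1 _ (hgΩ y) y this.2 (hg y)
  have hgrad : ∀ x ∈ Ω, HasGradientAt φ (T x) x := fun x hx =>
    hasGradientAt_of_continuousAt_subgrad hΩ hT hx (hTcont x hx)
  have h0 : (0 : EuclideanSpace ℝ (Fin 2)) ∈ Ω := by simp [hΩdef]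
  have hK' : K = subgrad Ω φ 0 := by simp [hK, subgrad]
  refine ⟨⟨T 0, ?_⟩, fun x hx => (hgrad x hx).differentiableAt, ?_⟩
  · rw [hK']
    exact Subset.antisymm (fun y hy => huniq 0 h0 y hy _ (hT 0 h0))
      (singleton_subset_iff.2 (hT 0 h0))
  · exact ⟨{ toFun := fun x => T x
             invFun := fun y => ⟨g y, hgΩ y⟩
             left_inv := fun x => Subtype.ext
               (hinj _ (hgΩ _) _ x.2 _ (hg _) (hT _ x.2))
             right_inv := fun y => huniq _ (hgΩ y) _ (hT _ (hgΩ y)) _ (hg y)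
             continuous_toFun := continuous_iff_continuousAt.2 fun x =>
               (hTcont x x.2).comp continuous_subtype_val.continuousAt
             continuous_invFun := hgcont.subtype_mk _ },
      fun x => (hgrad x x.2).gradient.symm⟩
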